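/- Exact values for the Bell+R_z family: for every θ ∈ ℝ, the two-qubit state ρ_θ = |Φ_θ⟩⟨Φ_θ| with |Φ_θ⟩ = (1/√2)(|00⟩ + e^{iθ}|11⟩) satisfies C(ρ_θ) = |sin θ| + |cos θ| − 1 and Γ(ρ_θ) = |sin θ| + |cos θ|; in particular Γ(ρ_θ) − 1 = C(ρ_θ), so the tightness ratio κ(ρ_θ) = (Γ(ρ_θ) − 1)/C(ρ_θ) equals 1 whenever C(ρ_θ) > 0. -/

import Mathlib

open Matrix Kronecker Finset
open scoped ComplexOrder

noncomputable section

def PX : Matrix (Fin 2) (Fin 2) ℂ := !![0, 1; 1, 0]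
def PY : Matrix (Fin 2) (Fin 2) ℂ := !![0, -Complex.I; Complex.I, 0]
def PZ : Matrix (Fin 2) (Fin 2) ℂ := !![1, 0; 0, -1]

/-- The single-qubit phase-point operator `A_{(q,p)}`. -/
def A1 (a : ZMod 2 × ZMod 2) : Matrix (Fin 2) (Fin 2) ℂ :=
  (1 / 2 : ℂ) • ((1 : Matrix (Fin 2) (Fin 2) ℂ)
    + ((-1 : ℂ) ^ a.2.val) • PX
    + ((-1 : ℂ) ^ (a.1.val + a.2.val)) • PY
    + ((-1 : ℂ) ^ a.1.val) • PZ)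

def pauli : Fin 4 → Matrix (Fin 2) (Fin 2) ℂ := ![1, PX, PY, PZ]

/-- A density matrix: positive semidefinite with unit trace. -/
def IsDensity {d : ℕ} (ρ : Matrix (Fin d) (Fin d) ℂ) : Prop :=
  ρ.PosSemidef ∧ ρ.trace = 1

/-- Kronecker product of 2×2 matrices as a 4×4 matrix. -/
def kron2 (M N : Matrix (Fin 2) (Fin 2) ℂ) : Matrix (Fin 4) (Fin 4) ℂ :=
  Matrix.reindex (finProdFinEquiv.trans (finCongr (by norm_num)))
    (finProdFinEquiv.trans (finCongr (by norm_num))) (M ⊗ₖ N)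

/-- The two-qubit phase-point operator `A_α = A_{α₁} ⊗ A_{α₂}`. -/
def A2 (α : (ZMod 2 × ZMod 2) × (ZMod 2 × ZMod 2)) : Matrix (Fin 4) (Fin 4) ℂ :=
  kron2 (A1 α.1) (A1 α.2)

/-- The two-qubit Pauli group `P₂`. -/
def Pauli2 : Set (Matrix (Fin 4) (Fin 4) ℂ) :=
  { M | ∃ (k : Fin 4) (P Q : Fin 4), M = Complex.I ^ (k : ℕ) • kron2 (pauli P) (pauli Q) }

/-- `S` is an abelian subgroup of `P₂` with `|S| = 4` and `-I ∉ S`. -/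
def IsStabGroup2 (S : Finset (Matrix (Fin 4) (Fin 4) ℂ)) : Prop :=
  (∀ g ∈ S, g ∈ Pauli2) ∧ (1 : Matrix (Fin 4) (Fin 4) ℂ) ∈ S ∧
  (∀ g ∈ S, ∀ h ∈ S, g * h ∈ S ∧ g * h = h * g) ∧
  S.card = 4 ∧ (-1 : Matrix (Fin 4) (Fin 4) ℂ) ∉ S

/-- The pure two-qubit stabilizer states. -/
def Stab2 : Set (Matrix (Fin 4) (Fin 4) ℂ) :=
  { σ | ∃ S : Finset (Matrix (Fin 4) (Fin 4) ℂ),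
      IsStabGroup2 S ∧ σ = (4 : ℂ)⁻¹ • ∑ g ∈ S, g }

/-- Two-qubit discrete Wigner function (of any 4×4 matrix). -/
def W2 (ρ : Matrix (Fin 4) (Fin 4) ℂ) (α : (ZMod 2 × ZMod 2) × (ZMod 2 × ZMod 2)) : ℝ :=
  ((4 : ℂ)⁻¹ * (ρ * A2 α).trace).re

/-- Two-qubit free Wigner polytope. -/
def WFree2 : Set (((ZMod 2 × ZMod 2) × (ZMod 2 × ZMod 2)) → ℝ) :=
  convexHull ℝ { w | ∃ σ ∈ Stab2, w = W2 σ }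

/-- Two-qubit Wigner distance `C(ρ)`. -/
def C2 (ρ : Matrix (Fin 4) (Fin 4) ℂ) : ℝ :=
  sInf { d | ∃ f ∈ WFree2, d = ∑ α, |W2 ρ α - f α| }

/-- Two-qubit stabilizer extent `Γ(ρ)`. -/
def Gam2 (ρ : Matrix (Fin 4) (Fin 4) ℂ) : ℝ :=
  sInf { t | ∃ (k : ℕ) (a : Fin k → ℝ) (s : Fin k → Matrix (Fin 4) (Fin 4) ℂ),
      (∀ i, s i ∈ Stab2) ∧ ρ = ∑ i, a i • s i ∧ t = ∑ i, |a i| }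

/-- Rank-one projection `|ψ⟩⟨ψ|`. -/
def proj (ψ : Fin 4 → ℂ) : Matrix (Fin 4) (Fin 4) ℂ :=
  Matrix.vecMulVec ψ fun j => (starRingEnd ℂ) (ψ j)

/-- The basis vector `|00⟩`. -/
def e0 : Fin 4 → ℂ := fun i => if i = 0 then 1 else 0

/-- The basis vector `|11⟩`. -/
def e3 : Fin 4 → ℂ := fun i => if i = 3 then 1 else 0

/-- `|ψ_θ⟩ = cos(θ/2)|00⟩ + sin(θ/2)|11⟩` (the R_y family). -/
def psiRy (θ : ℝ) : Fin 4 → ℂ := fun i =>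
  if i = 0 then ((Real.cos (θ / 2) : ℝ) : ℂ)
  else if i = 3 then ((Real.sin (θ / 2) : ℝ) : ℂ) else 0

/-- `|ψ_θ⟩ = cos(θ/2)|00⟩ − i sin(θ/2)|11⟩` (the R_x family). -/
def psiRx (θ : ℝ) : Fin 4 → ℂ := fun i =>
  if i = 0 then ((Real.cos (θ / 2) : ℝ) : ℂ)
  else if i = 3 then -Complex.I * ((Real.sin (θ / 2) : ℝ) : ℂ) else 0

/-- `|Φ_θ⟩ = (1/√2)(|00⟩ + e^{iθ}|11⟩)` (the Bell+R_z family). -/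
def psiB (θ : ℝ) : Fin 4 → ℂ := fun i =>
  if i = 0 then (((Real.sqrt 2 : ℝ) : ℂ))⁻¹
  else if i = 3 then Complex.exp (θ * Complex.I) / ((Real.sqrt 2 : ℝ) : ℂ) else 0

/-- `|+_L⟩ = (1/√2)(|00⟩ + |11⟩)`. -/
def pPlus : Fin 4 → ℂ := fun i =>
  if i = 0 then (((Real.sqrt 2 : ℝ) : ℂ))⁻¹
  else if i = 3 then (((Real.sqrt 2 : ℝ) : ℂ))⁻¹ else 0

/-- `|−_L⟩ = (1/√2)(|00⟩ − |11⟩)`. -/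
def pMinus : Fin 4 → ℂ := fun i =>
  if i = 0 then (((Real.sqrt 2 : ℝ) : ℂ))⁻¹
  else if i = 3 then -(((Real.sqrt 2 : ℝ) : ℂ))⁻¹ else 0


lemma kron2_eq (M N : Matrix (Fin 2) (Fin 2) ℂ) : kron2 M N =
    !![M 0 0 * N 0 0, M 0 0 * N 0 1, M 0 1 * N 0 0, M 0 1 * N 0 1;
       M 0 0 * N 1 0, M 0 0 * N 1 1, M 0 1 * N 1 0, M 0 1 * N 1 1;
       M 1 0 * N 0 0, M 1 0 * N 0 1, M 1 1 * N 0 0, M 1 1 * N 0 1;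
       M 1 0 * N 1 0, M 1 0 * N 1 1, M 1 1 * N 1 0, M 1 1 * N 1 1] := by
  ext i j
  fin_cases i <;> fin_cases j <;> rfl

lemma kron2_mul (A B C D : Matrix (Fin 2) (Fin 2) ℂ) :
    kron2 A B * kron2 C D = kron2 (A * C) (B * D) := by
  simp only [kron2, Matrix.reindex_apply, Matrix.mul_kronecker_mul, Matrix.submatrix_mul_equiv]

lemma kron2_one : kron2 1 1 = 1 := by
  simp [kron2]

lemma pauli_mul_self (P : Fin 4) : pauli P * pauli P = 1 := by
  fin_cases P <;> simp [pauli, PX, PY, PZ, Matrix.one_fin_two]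

lemma Pauli2.exists_left_inverse {g : Matrix (Fin 4) (Fin 4) ℂ} (hg : g ∈ Pauli2) :
    ∃ h, h * g = 1 := by
  obtain ⟨k, P, Q, rfl⟩ := hg
  refine ⟨(Complex.I ^ (k : ℕ))⁻¹ • kron2 (pauli P) (pauli Q), ?_⟩
  rw [Matrix.smul_mul, Matrix.mul_smul, kron2_mul, pauli_mul_self, pauli_mul_self, kron2_one,
    smul_smul, inv_mul_cancel₀ (pow_ne_zero _ Complex.I_ne_zero), one_smul]

/-- The zero patterns of the outer rows of a Pauli matrix. -/
lemma Pauli2.corner_cases {g : Matrix (Fin 4) (Fin 4) ℂ} (hg : g ∈ Pauli2) :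
    (g 0 3 = 0 ∧ g 3 0 = 0) ∨
      (g 0 0 = 0 ∧ g 0 1 = 0 ∧ g 0 2 = 0 ∧ g 3 1 = 0 ∧ g 3 2 = 0 ∧ g 3 3 = 0) := by
  obtain ⟨k, P, Q, rfl⟩ := hg
  fin_cases P <;> fin_cases Q <;> simp [kron2_eq, pauli, PX, PY, PZ]

/-- Every entry of a Pauli matrix is zero or a fourth root of unity. -/
lemma Pauli2.apply_mem {g : Matrix (Fin 4) (Fin 4) ℂ} (hg : g ∈ Pauli2) (i j : Fin 4) :
    g i j ∈ ({0, 1, -1, Complex.I, -Complex.I} : Set ℂ) := by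
  have hp : ∀ (P : Fin 4) (i j : Fin 2),
      pauli P i j ∈ ({0, 1, -1, Complex.I, -Complex.I} : Set ℂ) := by
    intro P i j
    fin_cases P <;> fin_cases i <;> fin_cases j <;> simp [pauli, PX, PY, PZ]
  have hm : ∀ a ∈ ({0, 1, -1, Complex.I, -Complex.I} : Set ℂ),
      ∀ b ∈ ({0, 1, -1, Complex.I, -Complex.I} : Set ℂ),
      a * b ∈ ({0, 1, -1, Complex.I, -Complex.I} : Set ℂ) := by
    rintro a (rfl | rfl | rfl | rfl | rfl) b (rfl | rfl | rfl | rfl | rfl) <;> simp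
  have hk : ∀ n : ℕ, Complex.I ^ n ∈ ({0, 1, -1, Complex.I, -Complex.I} : Set ℂ) := by
    intro n
    induction n with
    | zero => simp
    | succ n ih => rw [pow_succ]; exact hm _ ih _ (by simp)
  obtain ⟨k, P, Q, rfl⟩ := hg
  exact hm _ (hk _) _ (hm _ (hp _ _ _) _ (hp _ _ _))

/-- The functional `M ↦ Re Tr (M B)` for `B = (c (XX - YY) + s (XY + YX)) / 2`. -/
def cornerFun (c s : ℝ) (M : Matrix (Fin 4) (Fin 4) ℂ) : ℝ :=
  c * ((M 0 3).re + (M 3 0).re) + s * ((M 3 0).im - (M 0 3).im)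

lemma cornerFun_sum {ι : Type*} (c s : ℝ) (t : Finset ι) (M : ι → Matrix (Fin 4) (Fin 4) ℂ) :
    cornerFun c s (∑ i ∈ t, M i) = ∑ i ∈ t, cornerFun c s (M i) := by
  simp only [cornerFun, Matrix.sum_apply, Complex.re_sum, Complex.im_sum, Finset.sum_add_distrib,
    Finset.sum_sub_distrib, ← Finset.mul_sum]

lemma cornerFun_smul (c s a : ℝ) (M : Matrix (Fin 4) (Fin 4) ℂ) :
    cornerFun c s (a • M) = a * cornerFun c s M := by
  simp only [cornerFun, Matrix.smul_apply, Complex.real_smul, Complex.re_ofReal_mul,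
    Complex.im_ofReal_mul]
  ring

lemma abs_cornerFun_pauli_le {c s : ℝ} (hc : |c| = 1) (hs : |s| = 1)
    {g : Matrix (Fin 4) (Fin 4) ℂ} (hg : g ∈ Pauli2) : |cornerFun c s g| ≤ 2 := by
  have key : ∀ z ∈ ({0, 1, -1, Complex.I, -Complex.I} : Set ℂ), ∀ t : ℝ, |t| = 1 →
      |c * z.re + t * z.im| ≤ 1 := by
    rintro z (rfl | rfl | rfl | rfl | rfl) t ht <;> simp [hc, ht]
  have h1 := key _ (Pauli2.apply_mem hg 0 3) (-s) (by simpa using hs)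
  have h2 := key _ (Pauli2.apply_mem hg 3 0) s hs
  rw [abs_le] at *
  unfold cornerFun
  constructor <;> linarith

lemma abs_cornerFun_add_le {c s : ℝ} (hc : |c| = 1) (hs : |s| = 1)
    {g h : Matrix (Fin 4) (Fin 4) ℂ} (hg : g ∈ Pauli2) (hh : h ∈ Pauli2) (hgh : g * h ∈ Pauli2)
    (hne : cornerFun c s g ≠ 0) : |cornerFun c s h| + |cornerFun c s (g * h)| ≤ 2 := by
  rcases Pauli2.corner_cases hg with ⟨h1, h2⟩ | ⟨h1, h2, h3, h4, h5, h6⟩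
  · simp [cornerFun, h1, h2] at hne
  rcases Pauli2.corner_cases hh with ⟨k1, k2⟩ | ⟨k1, k2, k3, k4, k5, k6⟩
  · have : cornerFun c s h = 0 := by simp [cornerFun, k1, k2]
    simpa [this] using abs_cornerFun_pauli_le hc hs hgh
  · have : cornerFun c s (g * h) = 0 := by
      simp [cornerFun, Matrix.mul_apply, Fin.sum_univ_four, *]
    simpa [this] using abs_cornerFun_pauli_le hc hs hh

lemma abs_cornerFun_stab_le {c s : ℝ} (hc : |c| = 1) (hs : |s| = 1)
    {σ : Matrix (Fin 4) (Fin 4) ℂ} (hσ : σ ∈ Stab2) : |cornerFun c s σ| ≤ 1 := by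
  obtain ⟨S, ⟨hP, -, hmul, hcard, -⟩, rfl⟩ := hσ
  have hsum : ∑ g ∈ S, |cornerFun c s g| ≤ 4 := by
    by_cases hz : ∀ g ∈ S, cornerFun c s g = 0
    · rw [Finset.sum_eq_zero fun g hg => by rw [hz g hg, abs_zero]]
      norm_num
    push Not at hz
    obtain ⟨g, hg, hne⟩ := hz
    have hinj : Set.InjOn (fun h => g * h) (S : Set (Matrix (Fin 4) (Fin 4) ℂ)) := by
      obtain ⟨g', hg'⟩ := Pauli2.exists_left_inverse (hP g hg)
      intro a _ b _ hab
      simpa [← Matrix.mul_assoc, hg'] using congrArg (fun h => g' * h) hab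
    have hmaps : Set.MapsTo (fun h => g * h) (S : Set (Matrix (Fin 4) (Fin 4) ℂ)) S :=
      fun h hh => (hmul g hg h hh).1
    have hperm : ∑ h ∈ S, |cornerFun c s (g * h)| = ∑ h ∈ S, |cornerFun c s h| :=
      Finset.sum_nbij (fun h => g * h) hmaps hinj
        (Finset.surjOn_of_injOn_of_card_le _ hmaps hinj le_rfl) fun _ _ => rfl
    have hle : ∑ h ∈ S, (|cornerFun c s h| + |cornerFun c s (g * h)|) ≤ ∑ _h ∈ S, (2 : ℝ) :=
      Finset.sum_le_sum fun h hh =>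
        abs_cornerFun_add_le hc hs (hP g hg) (hP h hh) (hP _ (hmul g hg h hh).1) hne
    rw [Finset.sum_add_distrib, hperm, Finset.sum_const, hcard] at hle
    norm_num at hle
    linarith
  have hsm : ((4 : ℂ)⁻¹ • ∑ g ∈ S, g) = (4 : ℝ)⁻¹ • ∑ g ∈ S, g := by
    ext i j
    simp [Complex.real_smul]
  rw [hsm, cornerFun_smul, cornerFun_sum, abs_mul, abs_of_pos (by norm_num : (0 : ℝ) < 4⁻¹)]
  linarith [Finset.abs_sum_le_sum_abs (fun g => cornerFun c s g) S]

/-- The state `(II + ZZ + c (XX - YY) + s (XY + YX)) / 4`. -/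
def bellMix (c s : ℝ) : Matrix (Fin 4) (Fin 4) ℂ :=
  !![1 / 2, 0, 0, (c - s * Complex.I) / 2; 0, 0, 0, 0; 0, 0, 0, 0;
     (c + s * Complex.I) / 2, 0, 0, 1 / 2]

lemma proj_psiB (θ : ℝ) : proj (psiB θ) = bellMix (Real.cos θ) (Real.sin θ) := by
  have hw : ((Real.sqrt 2 : ℝ) : ℂ)⁻¹ * ((Real.sqrt 2 : ℝ) : ℂ)⁻¹ = 1 / 2 := by
    rw [← mul_inv, ← Complex.ofReal_mul, Real.mul_self_sqrt (by norm_num)]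
    norm_num
  have hcs : (Real.cos θ : ℂ) ^ 2 + (Real.sin θ : ℂ) ^ 2 = 1 := by
    exact_mod_cast Real.cos_sq_add_sin_sq θ
  have hexp : Complex.exp (θ * Complex.I) = Real.cos θ + Real.sin θ * Complex.I := by
    rw [Complex.exp_mul_I, Complex.ofReal_cos, Complex.ofReal_sin]
  ext i j
  rw [proj, Matrix.vecMulVec_apply]
  simp only [psiB, hexp, bellMix]
  generalize Real.cos θ = c at *
  generalize Real.sin θ = s at *
  fin_cases i <;> fin_cases j <;> simp [div_eq_mul_inv]
  · linear_combination hw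
  · linear_combination (c - s * Complex.I) * hw
  · linear_combination (c + s * Complex.I) * hw
  · linear_combination (c ^ 2 - s ^ 2 * Complex.I ^ 2) * hw + hcs / 2 - s ^ 2 / 2 * Complex.I_sq

lemma Stab2.of_generators {g h k : Matrix (Fin 4) (Fin 4) ℂ} (h1P : 1 ∈ Pauli2)
    (hgP : g ∈ Pauli2) (hhP : h ∈ Pauli2) (hkP : k ∈ Pauli2)
    (hg : g * g = 1) (hh : h * h = 1) (hgh : g * h = k) (hhg : h * g = k)
    (hd : 1 ≠ g ∧ 1 ≠ h ∧ 1 ≠ k ∧ g ≠ h ∧ g ≠ k ∧ h ≠ k)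
    (hn : -1 ≠ g ∧ -1 ≠ h ∧ -1 ≠ k) :
    (4 : ℂ)⁻¹ • (1 + (g + (h + k))) ∈ Stab2 := by
  obtain ⟨d1, d2, d3, d4, d5, d6⟩ := hd
  have hgk : g * k = h := by rw [← hgh, ← Matrix.mul_assoc, hg, Matrix.one_mul]
  have hkg : k * g = h := by rw [← hhg, Matrix.mul_assoc, hg, Matrix.mul_one]
  have hhk : h * k = g := by rw [← hhg, ← Matrix.mul_assoc, hh, Matrix.one_mul]
  have hkh : k * h = g := by rw [← hgh, Matrix.mul_assoc, hh, Matrix.mul_one]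
  have hkk : k * k = 1 := by
    nth_rw 1 [← hgh]
    rw [Matrix.mul_assoc, hhk, hg]
  have h11 : (-1 : Matrix (Fin 4) (Fin 4) ℂ) ≠ 1 := by
    intro h
    have := congrFun (congrFun h 0) 0
    norm_num at this
  refine ⟨{1, g, h, k}, ⟨?_, by simp, ?_, ?_, by simp [hn, h11]⟩, ?_⟩
  · simp [h1P, hgP, hhP, hkP]
  · simp [hg, hh, hgh, hhg, hgk, hkg, hhk, hkh, hkk]
  · simp [*]
  · rw [Finset.sum_insert (by simp [*]), Finset.sum_insert (by simp [*]),
      Finset.sum_insert (by simp [*]), Finset.sum_singleton]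

lemma one_mem_Pauli2 : (1 : Matrix (Fin 4) (Fin 4) ℂ) ∈ Pauli2 :=
  ⟨0, 0, 0, by simp [pauli, kron2_one]⟩

lemma kron2_pauli_mem_Pauli2 (P Q : Fin 4) : kron2 (pauli P) (pauli Q) ∈ Pauli2 :=
  ⟨0, P, Q, by simp⟩

lemma smul_kron2_pauli_mem_Pauli2 {ε : ℝ} (hε : ε = 1 ∨ ε = -1) (P Q : Fin 4) :
    (ε : ℂ) • kron2 (pauli P) (pauli Q) ∈ Pauli2 := by
  rcases hε with rfl | rfl
  · exact ⟨0, P, Q, by simp⟩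
  · exact ⟨2, P, Q, by simp⟩

lemma neg_eq_one_or_neg_eq_neg_one {ε : ℝ} (hε : ε = 1 ∨ ε = -1) : -ε = 1 ∨ -ε = -1 :=
  hε.symm.imp (fun h => by simp [h]) fun h => by simp [h]

lemma bellMix_left_mem_Stab2 {ε : ℝ} (hε : ε = 1 ∨ ε = -1) : bellMix ε 0 ∈ Stab2 := by
  have key := Stab2.of_generators one_mem_Pauli2 (kron2_pauli_mem_Pauli2 3 3)
    (smul_kron2_pauli_mem_Pauli2 hε 1 1)
    (smul_kron2_pauli_mem_Pauli2 (ε := -ε) (neg_eq_one_or_neg_eq_neg_one hε) 2 2)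
  have heq : bellMix ε 0 = (4 : ℂ)⁻¹ • (1 + (kron2 (pauli 3) (pauli 3) +
      ((ε : ℂ) • kron2 (pauli 1) (pauli 1) + ((-ε : ℝ) : ℂ) • kron2 (pauli 2) (pauli 2)))) := by
    ext i j
    fin_cases i <;> fin_cases j <;> simp [bellMix, kron2_eq, pauli, PX, PY, PZ] <;> ring
  rw [heq]
  have hε0 : (ε : ℂ) * ε = 1 := by rcases hε with rfl | rfl <;> norm_num
  have hne : (ε : ℂ) ≠ 0 := left_ne_zero_of_mul_eq_one hε0
  apply key
  · rw [kron2_mul, pauli_mul_self, kron2_one]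
  · rw [Matrix.smul_mul, Matrix.mul_smul, kron2_mul, pauli_mul_self, kron2_one, smul_smul, hε0,
      one_smul]
  · ext i j
    fin_cases i <;> fin_cases j <;> simp [kron2_eq, pauli, PX, PY, PZ]
  · ext i j
    fin_cases i <;> fin_cases j <;> simp [kron2_eq, pauli, PX, PY, PZ]
  · refine ⟨fun h => ?_, fun h => ?_, fun h => ?_, fun h => ?_, fun h => ?_, fun h => ?_⟩
    all_goals
      have a := congrFun (congrFun h 0) 3
      have b := congrFun (congrFun h 1) 1
      have c := congrFun (congrFun h 1) 2
      simp [kron2_eq, pauli, PX, PY, PZ, hne, self_eq_neg] at a b c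
  · refine ⟨fun h => ?_, fun h => ?_, fun h => ?_⟩
    all_goals
      have a := congrFun (congrFun h 0) 0
      simp [kron2_eq, pauli, PX, PY, PZ, neg_eq_self] at a

lemma bellMix_right_mem_Stab2 {ε : ℝ} (hε : ε = 1 ∨ ε = -1) : bellMix 0 ε ∈ Stab2 := by
  have key := Stab2.of_generators one_mem_Pauli2 (kron2_pauli_mem_Pauli2 3 3)
    (smul_kron2_pauli_mem_Pauli2 hε 1 2) (smul_kron2_pauli_mem_Pauli2 hε 2 1)
  have heq : bellMix 0 ε = (4 : ℂ)⁻¹ • (1 + (kron2 (pauli 3) (pauli 3) +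
      ((ε : ℂ) • kron2 (pauli 1) (pauli 2) + (ε : ℂ) • kron2 (pauli 2) (pauli 1)))) := by
    ext i j
    fin_cases i <;> fin_cases j <;> simp [bellMix, kron2_eq, pauli, PX, PY, PZ] <;> ring
  rw [heq]
  have hε0 : (ε : ℂ) * ε = 1 := by rcases hε with rfl | rfl <;> norm_num
  have hne : (ε : ℂ) ≠ 0 := left_ne_zero_of_mul_eq_one hε0
  apply key
  · rw [kron2_mul, pauli_mul_self, kron2_one]
  · rw [Matrix.smul_mul, Matrix.mul_smul, kron2_mul, pauli_mul_self, pauli_mul_self, kron2_one,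
      smul_smul, hε0, one_smul]
  · ext i j
    fin_cases i <;> fin_cases j <;> simp [kron2_eq, pauli, PX, PY, PZ]
  · ext i j
    fin_cases i <;> fin_cases j <;> simp [kron2_eq, pauli, PX, PY, PZ]
  · refine ⟨fun h => ?_, fun h => ?_, fun h => ?_, fun h => ?_, fun h => ?_, fun h => ?_⟩
    all_goals
      have a := congrFun (congrFun h 0) 3
      have b := congrFun (congrFun h 1) 1
      have c := congrFun (congrFun h 1) 2
      simp [kron2_eq, pauli, PX, PY, PZ, hne, self_eq_neg] at a b c
  · refine ⟨fun h => ?_, fun h => ?_, fun h => ?_⟩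
    all_goals
      have a := congrFun (congrFun h 0) 0
      simp [kron2_eq, pauli, PX, PY, PZ, neg_eq_self] at a

/-- The sign pattern `α ↦ Re Tr (A_α B)` for the operator `B` of `cornerFun`. -/
def signF (c s : ℝ) (α : (ZMod 2 × ZMod 2) × (ZMod 2 × ZMod 2)) : ℝ :=
  if α.1.1 = α.2.1 then s * (-1) ^ (α.1.1.val + α.1.2.val + α.2.2.val)
  else c * (-1) ^ (α.1.2.val + α.2.2.val)

lemma sum_phase {M : Type*} [AddCommMonoid M] (f : ZMod 2 → M) : ∑ a, f a = f 0 + f 1 :=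
  Fin.sum_univ_two f

lemma W2_add (M N : Matrix (Fin 4) (Fin 4) ℂ) : W2 (M + N) = W2 M + W2 N := by
  ext α
  simp [W2, Matrix.add_mul, mul_add]

lemma W2_smul (a : ℝ) (M : Matrix (Fin 4) (Fin 4) ℂ) : W2 (a • M) = a • W2 M := by
  ext α
  simp [W2]
  ring

lemma ZMod.val_one_two : (1 : ZMod 2).val = 1 := rfl

lemma sum_signF_mul_W2 (c s : ℝ) (M : Matrix (Fin 4) (Fin 4) ℂ) :
    ∑ α, signF c s α * W2 M α = cornerFun c s M := by
  simp only [Fintype.sum_prod_type, sum_phase]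
  simp [signF, W2, A2, kron2_eq, A1, PX, PY, PZ, Matrix.trace, Matrix.mul_apply,
    Fin.sum_univ_four, ZMod.val_one_two, cornerFun]
  ring

lemma sum_abs_W2 : ∑ α, |W2 (bellMix 0 1 - bellMix 0 0) α| = 1 := by
  simp only [Fintype.sum_prod_type, sum_phase]
  simp [W2, A2, kron2_eq, A1, PX, PY, PZ, Matrix.trace,
    Fin.sum_univ_four, ZMod.val_one_two, bellMix]
  norm_num

lemma abs_signF {c s : ℝ} (hc : |c| = 1) (hs : |s| = 1)
    (α : (ZMod 2 × ZMod 2) × (ZMod 2 × ZMod 2)) : |signF c s α| = 1 := by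
  unfold signF
  split_ifs <;> simp [abs_mul, abs_pow, hc, hs]

lemma cornerFun_bellMix (c s x y : ℝ) : cornerFun c s (bellMix x y) = c * x + s * y := by
  simp [cornerFun, bellMix, -mul_eq_mul_left_iff]
  ring

lemma sum_signF_mul_le_of_mem_WFree2 {c s : ℝ} (hc : |c| = 1) (hs : |s| = 1)
    {f : (ZMod 2 × ZMod 2) × (ZMod 2 × ZMod 2) → ℝ} (hf : f ∈ WFree2) :
    ∑ α, signF c s α * f α ≤ 1 := by
  have hsub : WFree2 ⊆ {f | ∑ α, signF c s α * f α ≤ 1} := by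
    refine convexHull_min ?_ (convex_halfSpace_le ⟨fun f g => ?_, fun a f => ?_⟩ 1)
    · rintro _ ⟨σ, hσ, rfl⟩
      exact (sum_signF_mul_W2 c s σ).trans_le
        ((le_abs_self _).trans (abs_cornerFun_stab_le hc hs hσ))
    · simp [mul_add, Finset.sum_add_distrib]
    · simp [Finset.mul_sum, mul_left_comm]
  exact hsub hf

lemma exists_sign_mul_eq_abs (x : ℝ) : ∃ ε : ℝ, (ε = 1 ∨ ε = -1) ∧ ε * x = |x| ∧ ε * |x| = x := by
  rcases abs_cases x with ⟨h, -⟩ | ⟨h, -⟩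
  · exact ⟨1, by simp [h]⟩
  · exact ⟨-1, by simp [h]⟩

lemma abs_eq_one_of_sign {ε : ℝ} (hε : ε = 1 ∨ ε = -1) : |ε| = 1 := by
  rcases hε with rfl | rfl <;> simp

lemma Gam2_bellMix {c s : ℝ} (h : 1 ≤ |c| + |s|) (hs1 : |s| ≤ 1) :
    Gam2 (bellMix c s) = |c| + |s| := by
  obtain ⟨ε, hε, hεc, hcε⟩ := exists_sign_mul_eq_abs c
  obtain ⟨δ, hδ, hδs, hsδ⟩ := exists_sign_mul_eq_abs s
  refine IsLeast.csInf_eq ⟨⟨3, ![(1 + |c| - |s|) / 2, |s|, -((|c| + |s| - 1) / 2)],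
    ![bellMix ε 0, bellMix 0 δ, bellMix (-ε) 0], ?_, ?_, ?_⟩, ?_⟩
  · intro i
    fin_cases i
    · exact bellMix_left_mem_Stab2 hε
    · exact bellMix_right_mem_Stab2 hδ
    · exact bellMix_left_mem_Stab2 (neg_eq_one_or_neg_eq_neg_one hε)
  · have hcε' : (ε : ℂ) * (|c| : ℝ) = c := by exact_mod_cast hcε
    have hsδ' : (δ : ℂ) * (|s| : ℝ) = s := by exact_mod_cast hsδ
    ext i j
    fin_cases i <;> fin_cases j <;>
      simp [bellMix, Fin.sum_univ_three, -Complex.coe_algebraMap]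
    · ring
    · linear_combination -hcε' / 2 + hsδ' * Complex.I / 2
    · linear_combination -hcε' / 2 - hsδ' * Complex.I / 2
    · ring
  · simp only [Fin.sum_univ_three, Matrix.cons_val, abs_neg, abs_abs]
    rw [abs_of_nonneg (by linarith [abs_nonneg c] : 0 ≤ (1 + |c| - |s|) / 2),
      abs_of_nonneg (by linarith : 0 ≤ (|c| + |s| - 1) / 2)]
    ring
  · rintro _ ⟨k, a, σ, hσ, heq, rfl⟩
    calc |c| + |s| = cornerFun ε δ (bellMix c s) := by rw [cornerFun_bellMix, hεc, hδs]
      _ = ∑ i, a i * cornerFun ε δ (σ i) := by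
        rw [heq, cornerFun_sum]
        exact Finset.sum_congr rfl fun i _ => cornerFun_smul _ _ _ _
      _ ≤ ∑ i, |a i| := Finset.sum_le_sum fun i _ => by
        refine (le_abs_self _).trans ?_
        rw [abs_mul]
        exact mul_le_of_le_one_right (abs_nonneg _)
          (abs_cornerFun_stab_le (abs_eq_one_of_sign hε) (abs_eq_one_of_sign hδ) (hσ i))

lemma C2_bellMix {c s : ℝ} (h : 1 ≤ |c| + |s|) (hc1 : |c| ≤ 1) :
    C2 (bellMix c s) = |c| + |s| - 1 := by
  obtain ⟨ε, hε, hεc, hcε⟩ := exists_sign_mul_eq_abs c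
  obtain ⟨δ, hδ, hδs, hsδ⟩ := exists_sign_mul_eq_abs s
  refine IsLeast.csInf_eq ⟨⟨|c| • W2 (bellMix ε 0) + (1 - |c|) • W2 (bellMix 0 δ), ?_, ?_⟩, ?_⟩
  · have hL : W2 (bellMix ε 0) ∈ WFree2 :=
      subset_convexHull ℝ _ ⟨_, bellMix_left_mem_Stab2 hε, rfl⟩
    have hR : W2 (bellMix 0 δ) ∈ WFree2 :=
      subset_convexHull ℝ _ ⟨_, bellMix_right_mem_Stab2 hδ, rfl⟩
    exact convex_convexHull ℝ _ hL hR (abs_nonneg c) (by linarith) (by ring)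
  · have hdecomp : bellMix c s = (|c| • bellMix ε 0 + (1 - |c|) • bellMix 0 δ) +
        (δ * (|c| + |s| - 1)) • (bellMix 0 1 - bellMix 0 0) := by
      have hcε' : (ε : ℂ) * (|c| : ℝ) = c := by exact_mod_cast hcε
      have hsδ' : (δ : ℂ) * (|s| : ℝ) = s := by exact_mod_cast hsδ
      ext i j
      fin_cases i <;> fin_cases j <;> simp [bellMix]
      · ring
      · linear_combination -hcε' / 2 + hsδ' * Complex.I / 2
      · linear_combination -hcε' / 2 - hsδ' * Complex.I / 2
      · ring
    rw [hdecomp]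
    simp only [W2_add, W2_smul, Pi.add_apply, add_sub_cancel_left, Pi.smul_apply, smul_eq_mul,
      abs_mul, ← Finset.mul_sum, sum_abs_W2, abs_eq_one_of_sign hδ]
    rw [abs_of_nonneg (by linarith : 0 ≤ |c| + |s| - 1)]
    ring
  · rintro _ ⟨f, hf, rfl⟩
    have hε1 := abs_eq_one_of_sign hε
    have hδ1 := abs_eq_one_of_sign hδ
    calc |c| + |s| - 1 ≤ cornerFun ε δ (bellMix c s) - ∑ α, signF ε δ α * f α := by
          rw [cornerFun_bellMix, hεc, hδs]
          linarith [sum_signF_mul_le_of_mem_WFree2 hε1 hδ1 hf]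
      _ = ∑ α, signF ε δ α * (W2 (bellMix c s) α - f α) := by
        simp only [← sum_signF_mul_W2, mul_sub, Finset.sum_sub_distrib]
      _ ≤ ∑ α, |W2 (bellMix c s) α - f α| := Finset.sum_le_sum fun α _ => by
        refine (le_abs_self _).trans_eq ?_
        rw [abs_mul, abs_signF hε1 hδ1, one_mul]

/-- exact values for the Bell+R_z family:
`C = |sin θ| + |cos θ| − 1`, `Γ = |sin θ| + |cos θ|`, hence `κ = 1`. -/
theorem kappa_BellRz (θ : ℝ) :
    C2 (proj (psiB θ)) = |Real.sin θ| + |Real.cos θ| - 1 ∧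
    Gam2 (proj (psiB θ)) = |Real.sin θ| + |Real.cos θ| ∧
    Gam2 (proj (psiB θ)) - 1 = C2 (proj (psiB θ)) ∧
    (0 < C2 (proj (psiB θ)) →
      (Gam2 (proj (psiB θ)) - 1) / C2 (proj (psiB θ)) = 1) := by
  have hc := Real.abs_cos_le_one θ
  have hs := Real.abs_sin_le_one θ
  have hle : 1 ≤ |Real.cos θ| + |Real.sin θ| := by
    nlinarith [Real.cos_sq_add_sin_sq θ, sq_abs (Real.cos θ), sq_abs (Real.sin θ),
      abs_nonneg (Real.cos θ), abs_nonneg (Real.sin θ)]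
  have hC : C2 (proj (psiB θ)) = |Real.sin θ| + |Real.cos θ| - 1 := by
    rw [proj_psiB, C2_bellMix hle hc, add_comm |Real.cos θ|]
  have hG : Gam2 (proj (psiB θ)) = |Real.sin θ| + |Real.cos θ| := by
    rw [proj_psiB, Gam2_bellMix hle hs, add_comm]
  have hGC : Gam2 (proj (psiB θ)) - 1 = C2 (proj (psiB θ)) := by rw [hG, hC]
  exact ⟨hC, hG, hGC, fun hpos => by rw [hGC, div_self hpos.ne']⟩
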